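/- arXiv:2405.16166 — 4 statements merged into one kernel-verified Lean document; each statement's English description precedes it below -/
import Mathlib

section
/- Let n ≥ 1 and k, ℓ ∈ ℕ, and let A ∈ ℚ^{k×n}, A' ∈ ℚ^{ℓ×n}, z ∈ ℚ^k, z' ∈ ℚ^ℓ. If there exists x ∈ ℝ^n such that (A x)_i > z_i for every i ∈ {1,…,k} and (A' x)_j ≥ z'_j for every j ∈ {1,…,ℓ} (with rational matrices and vectors viewed inside ℝ), then there exists r ∈ ℚ^n such that (A r)_i > z_i for every i and (A' r)_j ≥ z'_j for every j. -/
open Filter Topology in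
/-- The identity of `ℝ` is a pointwise limit of `ℚ`-linear functionals with rational values. -/
theorem exists_seq_rat_linearMap_tendsto :
    ∃ f : ℕ → ℝ →ₗ[ℚ] ℚ, ∀ s : ℝ, Tendsto (fun N => ((f N s : ℚ) : ℝ)) atTop (𝓝 s) := by
  let b := Module.Basis.ofVectorSpace ℚ ℝ
  choose q _ _ hq using fun i => Real.exists_seq_rat_strictMono_tendsto (b i)
  refine ⟨fun N => b.constr ℚ fun i => q i N, fun s => ?_⟩
  have hs : s = ∑ i ∈ (b.repr s).support, (b.repr s i : ℝ) * b i := by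
    conv_lhs => rw [← b.linearCombination_repr s, Finsupp.linearCombination_apply, Finsupp.sum]
    simp only [Rat.smul_def]
  have hf : ∀ N, ((b.constr ℚ (fun i => q i N) s : ℚ) : ℝ) =
      ∑ i ∈ (b.repr s).support, (b.repr s i : ℝ) * q i N := by
    intro N
    rw [b.constr_apply, Finsupp.sum]
    push_cast [smul_eq_mul]
    rfl
  simp only [hf]
  conv => arg 3; rw [hs]
  exact tendsto_finsetSum _ fun i _ => (hq i).const_mul _

theorem rational_solution_of_real_solution (n k ℓ : ℕ) (hn : 1 ≤ n)
    (A : Matrix (Fin k) (Fin n) ℚ) (A' : Matrix (Fin ℓ) (Fin n) ℚ)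
    (z : Fin k → ℚ) (z' : Fin ℓ → ℚ)
    (hx : ∃ x : Fin n → ℝ,
      (∀ i, (z i : ℝ) < ∑ j, (A i j : ℝ) * x j) ∧
      (∀ i, (z' i : ℝ) ≤ ∑ j, (A' i j : ℝ) * x j)) :
    ∃ r : Fin n → ℚ,
      (∀ i, z i < ∑ j, A i j * r j) ∧
      (∀ i, z' i ≤ ∑ j, A' i j * r j) := by
  obtain ⟨x, hA, hA'⟩ := hx
  obtain ⟨f, hf⟩ := exists_seq_rat_linearMap_tendsto
  have hpos : ∀ s : ℝ, 0 < s → ∀ᶠ N in Filter.atTop, 0 < f N s := fun s hs =>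
    ((hf s).eventually_const_lt hs).mono fun N h => by exact_mod_cast h
  have hnonneg : ∀ s : ℝ, 0 ≤ s → ∀ᶠ N in Filter.atTop, 0 ≤ f N s := by
    intro s hs
    rcases hs.eq_or_lt with rfl | hs
    · simp
    · exact (hpos s hs).mono fun N h => h.le
  obtain ⟨N, h1, h2, h3⟩ := ((hpos 1 one_pos).and
    ((Filter.eventually_all.2 fun i => hpos _ (sub_pos.2 (hA i))).and
      (Filter.eventually_all.2 fun i => hnonneg _ (sub_nonneg.2 (hA' i))))).exists
  have key : ∀ (a : Fin n → ℚ) (c : ℚ), f N (∑ j, (a j : ℝ) * x j - (c : ℝ)) =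
      f N 1 * (∑ j, a j * (f N (x j) / f N 1) - c) := by
    intro a c
    have hc : (c : ℝ) = c • (1 : ℝ) := by simp [Rat.smul_def]
    simp only [hc, ← Rat.smul_def, map_sub, map_sum, map_smul, smul_eq_mul]
    rw [mul_sub, Finset.mul_sum, mul_comm c]
    congr 1
    refine Finset.sum_congr rfl fun j _ => ?_
    field_simp
  refine ⟨fun j => f N (x j) / f N 1, fun i => ?_, fun i => ?_⟩
  · have h := h2 i
    rw [key] at h
    exact sub_pos.1 (pos_of_mul_pos_right h h1.le)
  · have h := h3 i
    rw [key] at h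
    exact sub_nonneg.1 (nonneg_of_mul_nonneg_right h h1)
end

section
/- No nondeterministic finite automaton over the infinite alphabet ℚ recognizes the language Double. Precisely: for every NFA M over the alphabet ℚ whose set of states is a finite type (with transition function assigning to each state and each letter a ∈ ℚ a set of successor states, a set of initial states, and a set of accepting states), the language accepted by M is not equal to Double = { [r₁,…,r_n] : n ≥ 1 and 2·r_i < r_{i+1} for all 1 ≤ i < n }, the set of nonempty finite sequences of rational numbers in which each element is more than double the preceding element. -/
/-- The language of nonempty sequences of rationals in which each element is
more than double the preceding one. -/
def Double : Language ℚ :=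
  {w | w ≠ [] ∧ ∀ (i : ℕ) (h : i + 1 < w.length),
    2 * w.get ⟨i, Nat.lt_of_succ_lt h⟩ < w.get ⟨i + 1, h⟩}

theorem pair_mem_double_iff (x y : ℚ) : [x, y] ∈ Double ↔ 2 * x < y := by
  constructor
  · rintro ⟨-, h⟩
    exact h 0 (by simp)
  · refine fun h ↦ ⟨by simp, fun i hi ↦ ?_⟩
    obtain rfl : i = 0 := by simpa using hi
    exact h

theorem no_nfa_recognizes_double (σ : Type) [Fintype σ] (M : NFA ℚ σ) :
    M.accepts ≠ Double := by
  intro hM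
  obtain ⟨x, y, hxy, heq⟩ :=
    Finite.exists_ne_map_eq_of_infinite fun x : ℚ ↦ M.evalFrom M.start [x]
  have key (z : ℚ) : 2 * x < z ↔ 2 * y < z := by
    rw [← pair_mem_double_iff, ← pair_mem_double_iff, ← hM]
    have split (a : ℚ) : M.evalFrom M.start [a, z] = M.evalFrom (M.evalFrom M.start [a]) [z] :=
      M.evalFrom_append M.start [a] [z]
    simp only [NFA.mem_accepts, split]
    rw [show M.evalFrom M.start [x] = M.evalFrom M.start [y] from heq]
  rcases lt_or_gt_of_ne hxy with h | h
  · exact lt_irrefl _ ((key (2 * y)).1 (by linarith))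
  · exact lt_irrefl _ ((key (2 * x)).2 (by linarith))
end

section
/- Pumping breaks membership in Double for positive sequences: let (a₁,…,a_m) ∈ Double with a_i > 0 for all i, and let 0 ≤ r < s ≤ m with r < s. Then the sequence a₁,…,a_r, a_{r+1},…,a_s, a_{r+1},…,a_s, a_{s+1},…,a_m obtained by repeating the (nonempty) block a_{r+1},…,a_s twice is not in Double. -/
theorem Double.pairwise_lt {w : List ℚ} (hw : w ∈ Double) (hpos : ∀ x ∈ w, 0 < x) :
    w.Pairwise (· < ·) := by
  rw [← List.isChain_iff_pairwise, List.isChain_iff_getElem]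
  intro i h
  have h_double := hw.2 i h
  have h_pos := hpos _ (List.getElem_mem (Nat.lt_of_succ_lt h))
  simp only [List.get_eq_getElem] at h_double
  linarith

theorem pumping_breaks_double (w : List ℚ) (hw : w ∈ Double)
    (hpos : ∀ x ∈ w, 0 < x) (r s : ℕ) (hrs : r < s) (hsm : s ≤ w.length) :
    w.take r ++ (w.drop r).take (s - r) ++ (w.drop r).take (s - r) ++ w.drop s ∉ Double := by
  intro h
  have h_lt := Double.pairwise_lt h fun x hx ↦ hpos x <| by
    simp only [List.mem_append] at hx
    rcases hx with ((hx | hx) | hx) | hx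
    · exact List.mem_of_mem_take hx
    · exact List.mem_of_mem_drop (List.mem_of_mem_take hx)
    · exact List.mem_of_mem_drop (List.mem_of_mem_take hx)
    · exact List.mem_of_mem_drop hx
  obtain ⟨x, hx⟩ : ∃ x, x ∈ (w.drop r).take (s - r) :=
    List.exists_mem_of_length_pos (by simp only [List.length_take, List.length_drop]; omega)
  have h_left := (List.pairwise_append.mp h_lt).1
  exact lt_irrefl x ((List.pairwise_append.mp h_left).2.2 x (List.mem_append_right _ hx) x hx)
end

section
/- The graph of the real exponential function, G = {(x, e^x) : x ∈ ℝ} ⊆ ℝ², is not a semialgebraic set. Precisely: there do not exist an N ∈ ℕ and, for each i ∈ {1,…,N}, a polynomial p_i ∈ ℝ[X,Y] and a finite family of polynomials q_{i,1},…,q_{i,k_i} ∈ ℝ[X,Y], such that G equals the union over i of the sets { v ∈ ℝ² : p_i(v) = 0 and q_{i,j}(v) > 0 for all j ∈ {1,…,k_i} }. -/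
open Filter Topology in
/-- For every real bivariate polynomial `Q`, the function `e⁻ᵗ Q(-t, e⁻ᵗ)` tends to `0` as
`t → ∞`. -/
theorem tendsto_exp_neg_mul_evalEval (Q : Polynomial (Polynomial ℝ)) :
    Tendsto (fun t : ℝ => Real.exp (-t) * Q.evalEval (-t) (Real.exp (-t))) atTop (𝓝 0) := by
  induction Q using Polynomial.induction_on' with
  | add p q hp hq => simpa [mul_add] using hp.add hq
  | monomial n a =>
    have h : Tendsto (fun t : ℝ => (a.comp (-Polynomial.X)).eval t / Real.exp t) atTop (𝓝 0) :=
      Polynomial.tendsto_div_exp_atTop _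
    refine squeeze_zero_norm' ?_ (tendsto_zero_iff_norm_tendsto_zero.1 h)
    filter_upwards [eventually_ge_atTop 0] with t ht
    have h1 : Real.exp (-t) ^ n ≤ 1 :=
      pow_le_one₀ (Real.exp_pos _).le (Real.exp_le_one_iff.2 (by linarith))
    have h2 : Real.exp (-t) * (Polynomial.monomial n a).evalEval (-t) (Real.exp (-t)) =
        ((a.comp (-Polynomial.X)).eval t / Real.exp t) * Real.exp (-t) ^ n := by
      simp [Polynomial.evalEval, Polynomial.eval_monomial, Real.exp_neg, Polynomial.eval_comp]
      ring
    rw [h2, norm_mul]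
    refine mul_le_of_le_one_right (norm_nonneg _) ?_
    rwa [Real.norm_of_nonneg (pow_nonneg (Real.exp_pos _).le n)]

open Filter Topology in
/-- A real polynomial tending to `0` along `-t`, `t → ∞`, is zero. -/
theorem Polynomial.eq_zero_of_tendsto_eval_neg {a : Polynomial ℝ}
    (h : Tendsto (fun t : ℝ => a.eval (-t)) atTop (𝓝 0)) : a = 0 := by
  have h' : Tendsto (fun t : ℝ => (a.comp (-Polynomial.X)).eval t) atTop (𝓝 0) := by
    simpa [Polynomial.eval_comp] using h
  rw [Polynomial.tendsto_nhds_iff] at h'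
  have h0 : a.comp (-Polynomial.X) = 0 := Polynomial.leadingCoeff_eq_zero.1 h'.1
  have := congrArg (fun p => Polynomial.comp p (-Polynomial.X)) h0
  simpa [Polynomial.comp_assoc] using this

/-- The exponential function is transcendental over `ℝ[X]`. -/
theorem eq_zero_of_evalEval_exp_eq_zero (Q : Polynomial (Polynomial ℝ))
    (hQ : ∀ x : ℝ, Q.evalEval x (Real.exp x) = 0) : Q = 0 := by
  induction hn : Q.natDegree using Nat.strong_induction_on generalizing Q with
  | _ n ih =>
    have hdecomp := Polynomial.divX_mul_X_add Q
    have hexpand (x : ℝ) : Q.divX.evalEval x (Real.exp x) * Real.exp x +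
        (Q.coeff 0).eval x = 0 := by
      have := hQ x
      rw [← hdecomp] at this
      simpa [Polynomial.evalEval_C] using this
    have hcoeff : Q.coeff 0 = 0 := by
      apply Polynomial.eq_zero_of_tendsto_eval_neg
      have h := (tendsto_exp_neg_mul_evalEval Q.divX).neg
      rw [neg_zero] at h
      refine h.congr fun t => ?_
      linarith [hexpand (-t)]
    have hdiv : Q.divX = 0 := by
      have hvanish (x : ℝ) : Q.divX.evalEval x (Real.exp x) = 0 := by
        have := hexpand x
        simpa [hcoeff, (Real.exp_pos x).ne'] using this
      rcases Nat.eq_zero_or_pos n with h0 | hpos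
      · rw [Polynomial.divX_eq_zero_iff]
        exact Polynomial.eq_C_of_natDegree_eq_zero (hn.trans h0)
      · exact ih _ (by rw [Polynomial.natDegree_divX_eq_natDegree_tsub_one]; omega) _ hvanish rfl
    rw [← hdecomp, hdiv, hcoeff]
    simp

/-- A polynomial in two variables vanishing on the graph of the exponential is zero. -/
theorem MvPolynomial.eq_zero_of_eval_exp_eq_zero (P : MvPolynomial (Fin 2) ℝ)
    (hP : ∀ x : ℝ, MvPolynomial.eval ![x, Real.exp x] P = 0) : P = 0 := by
  let φ : MvPolynomial (Fin 2) ℝ →ₐ[ℝ] Polynomial (Polynomial ℝ) :=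
    MvPolynomial.aeval ![Polynomial.C Polynomial.X, Polynomial.X]
  let ψ : Polynomial (Polynomial ℝ) →+* MvPolynomial (Fin 2) ℝ :=
    Polynomial.eval₂RingHom (Polynomial.eval₂RingHom MvPolynomial.C (MvPolynomial.X 0))
      (MvPolynomial.X 1)
  have hψφ : ψ.comp (φ : MvPolynomial (Fin 2) ℝ →+* _) = RingHom.id _ := by
    apply MvPolynomial.ringHom_ext
    · intro r
      simp [φ, ψ]
    · intro i
      fin_cases i <;> simp [φ, ψ]
  have heval (x y : ℝ) : (Polynomial.evalEvalRingHom x y).comp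
      (φ : MvPolynomial (Fin 2) ℝ →+* _) = MvPolynomial.eval ![x, y] := by
    apply MvPolynomial.ringHom_ext
    · intro r
      simp [φ]
    · intro i
      fin_cases i <;> simp [φ]
  have hφ : φ P = 0 := eq_zero_of_evalEval_exp_eq_zero _ fun x => by
    rw [← hP x, ← heval]
    rfl
  calc P = ψ (φ P) := (RingHom.congr_fun hψφ P).symm
    _ = 0 := by rw [hφ, map_zero]

/-- The graph of the exponential has empty interior. -/
theorem interior_exp_graph : interior {v : Fin 2 → ℝ | v 1 = Real.exp (v 0)} = ∅ := by
  rw [Set.eq_empty_iff_forall_notMem]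
  intro v hv
  have hcont : Continuous fun t : ℝ => Function.update v 1 t := by fun_prop
  have hmem : (fun t : ℝ => Function.update v 1 t) ⁻¹'
      interior {v : Fin 2 → ℝ | v 1 = Real.exp (v 0)} ⊆ {Real.exp (v 0)} := by
    intro t ht
    simpa using interior_subset ht
  have hopen := interior_maximal hmem (isOpen_interior.preimage hcont)
  rw [interior_singleton] at hopen
  exact hopen (a := v 1) (by simpa using hv)

theorem exp_graph_not_semialgebraic :
    ¬ ∃ (N : ℕ) (p : Fin N → MvPolynomial (Fin 2) ℝ) (k : Fin N → ℕ)
        (q : (i : Fin N) → Fin (k i) → MvPolynomial (Fin 2) ℝ),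
      {v : Fin 2 → ℝ | v 1 = Real.exp (v 0)} =
        ⋃ i, {v : Fin 2 → ℝ |
          MvPolynomial.eval v (p i) = 0 ∧ ∀ j, 0 < MvPolynomial.eval v (q i j)} := by
  classical
  rintro ⟨N, p, k, q, h⟩
  have hP : (∏ i with p i ≠ 0, p i) = 0 := by
    refine MvPolynomial.eq_zero_of_eval_exp_eq_zero _ fun x => ?_
    have hx : ![x, Real.exp x] ∈ {v : Fin 2 → ℝ | v 1 = Real.exp (v 0)} := by simp
    rw [h] at hx
    obtain ⟨i, hi, hq⟩ := Set.mem_iUnion.1 hx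
    have hpi : p i ≠ 0 := by
      intro h0
      have hopen : IsOpen {v : Fin 2 → ℝ | ∀ j, 0 < MvPolynomial.eval v (q i j)} := by
        rw [Set.ofPred_forall]
        exact isOpen_iInter_of_finite fun j =>
          isOpen_lt continuous_const (MvPolynomial.continuous_eval _)
      have hsub : {v : Fin 2 → ℝ | ∀ j, 0 < MvPolynomial.eval v (q i j)} ⊆
          {v : Fin 2 → ℝ | v 1 = Real.exp (v 0)} := by
        rw [h]
        exact fun v hv => Set.mem_iUnion.2 ⟨i, by simp [h0], hv⟩
      have := interior_maximal hsub hopen hq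
      rwa [interior_exp_graph] at this
    rw [map_prod]
    exact Finset.prod_eq_zero (by simpa using hpi) hi
  obtain ⟨i, hi, h0⟩ := Finset.prod_eq_zero_iff.1 hP
  exact (Finset.mem_filter.1 hi).2 h0
end
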